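/- For any homogeneous f, g, h ∈ A, the contact bracket satisfies the super Jacobi identity: {f,{g,h}_{k.b.}}_{k.b.} = {{f,g}_{k.b.},h}_{k.b.} + (−1)^{p(f)p(g)} {g,{f,h}_{k.b.}}_{k.b.}. -/

import Mathlib

/-!
We model the exterior (Grassmann) algebra `Λ` on `n` anticommuting generators over `ℂ`
concretely as the space of functions `Finset (Fin n) → ℂ` (coordinates with respect to the
monomial basis indexed by subsets of the generators, the generators being ordered by their
index).  For `2k` generators the first `k` indices are `ξ_1, …, ξ_k` and the last `k`
indices are `η_1, …, η_k`.
-/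

noncomputable section

/-- The Grassmann algebra on `n` generators: coordinates w.r.t. the basis of monomials
`θ_S = θ_{i_1}⋯θ_{i_r}` (`S = {i_1 < … < i_r}`). -/
abbrev Lam (n : ℕ) := Finset (Fin n) → ℂ

/-- Koszul sign of the multiplication `θ_S · θ_T` for disjoint `S`, `T`:
`(−1)^(number of pairs (s,t) ∈ S × T with t < s)`. -/
def ksign {n : ℕ} (S T : Finset (Fin n)) : ℂ :=
  (-1 : ℂ) ^ (∑ s ∈ S, (T.filter (fun t => t < s)).card)

/-- The (super)product on the Grassmann algebra `Lam n`:
`θ_S · θ_T = ksign S T · θ_{S ∪ T}` for disjoint `S`, `T`, zero otherwise,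
extended bilinearly. -/
def gmul {n : ℕ} (f g : Lam n) : Lam n :=
  fun U => ∑ S ∈ U.powerset, ksign S (U \ S) * f S * g (U \ S)

/-- The identity element `1` of the Grassmann algebra. -/
def oneLam {n : ℕ} : Lam n := fun S => if S = ∅ then 1 else 0

/-- `f` is homogeneous of `ℤ`-degree `d` (the parity `p f` is `d % 2`). -/
def IsHomog {n : ℕ} (d : ℕ) (f : Lam n) : Prop := ∀ S, f S ≠ 0 → S.card = d

/-- The odd derivation `∂_{θ_i}` of the Grassmann algebra: the unique odd derivation
sending the generator `θ_i` to `1` and all other generators to `0`.  On monomials: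
`∂_{θ_i} θ_T = (−1)^{#{j ∈ T : j < i}} θ_{T \ {i}}` if `i ∈ T`, and `0` otherwise. -/
def pd {n : ℕ} (i : Fin n) (f : Lam n) : Lam n :=
  fun S => if i ∈ S then 0 else ((-1 : ℂ) ^ (S.filter (fun j => j < i)).card) * f (insert i S)

/-- The operator multiplying each monomial of degree `d` by `−(−1)^d`; on a homogeneous
element `f` this is multiplication by `−(−1)^{p(f)}`.  It is used to extend the Poisson
bracket from homogeneous elements bilinearly. -/
def sgnF {n : ℕ} (f : Lam n) : Lam n :=
  fun S => (-(-1 : ℂ) ^ S.card) * f S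

/-- The index of the generator `ξ_j` among the `2k` generators. -/
def xIdx {k : ℕ} (j : Fin k) : Fin (2 * k) := ⟨j.1, by have := j.2; omega⟩

/-- The index of the generator `η_j` among the `2k` generators. -/
def yIdx {k : ℕ} (j : Fin k) : Fin (2 * k) := ⟨k + j.1, by have := j.2; omega⟩

/-- The Poisson bracket on `Lam (2k)`:
`{f,g} = −(−1)^{p(f)} ∑_{j=1}^{k} (∂_{ξ_j}f · ∂_{η_j}g + ∂_{η_j}f · ∂_{ξ_j}g)`
for homogeneous `f`, extended bilinearly (via `sgnF`).  `Lam (2k)` with this bracket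
is the Poisson superalgebra `po(0|2k)`. -/
def pbr {k : ℕ} (f g : Lam (2 * k)) : Lam (2 * k) :=
  ∑ j : Fin k,
    (gmul (pd (xIdx j) (sgnF f)) (pd (yIdx j) g) +
     gmul (pd (yIdx j) (sgnF f)) (pd (xIdx j) g))

/-- The Berezin integral `∫ f vol(θ)`: the coefficient of the top monomial
`ξ_1⋯ξ_k η_1⋯η_k`. -/
def berez {n : ℕ} (f : Lam n) : ℂ := f Finset.univ

/-- The bilinear form `B(f,g) = ∫ fg vol(θ)` on the Grassmann algebra. -/
def Bform {n : ℕ} (f g : Lam n) : ℂ := berez (gmul f g)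

end

/-!
The Laurent/loop level: `A = ℂ[t,t⁻¹] ⊗ Λ`, modelled as finitely supported functions
`ℤ →₀ Lam n` (the value at `m` is the coefficient of `t^m`).
-/

noncomputable section

/-- `ℂ[t,t⁻¹] ⊗ Λ`: Laurent polynomials in the even variable `t` with coefficients
in the Grassmann algebra `Lam n`. -/
abbrev LoopLam (n : ℕ) := ℤ →₀ Lam n

/-- The product on `LoopLam n`: `(t^m ⊗ x)(t^p ⊗ y) = t^{m+p} ⊗ (x·y)`. -/
def tmul {n : ℕ} (f g : LoopLam n) : LoopLam n :=
  f.sum fun m x => g.sum fun p y => Finsupp.single (m + p) (gmul x y)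

/-- Differentiation `∂_t` in the even variable `t`. -/
def dt {n : ℕ} (f : LoopLam n) : LoopLam n :=
  f.sum fun m x => Finsupp.single (m - 1) ((m : ℂ) • x)

/-- The Euler operator `E`: on `t^a ⊗ w` with `w` of Grassmann degree `d` it acts
as multiplication by `d`. -/
def euler {n : ℕ} (f : LoopLam n) : LoopLam n :=
  f.sum fun m x => Finsupp.single m (fun S => (S.card : ℂ) * x S)

/-- The Poisson bracket extended `ℂ[t,t⁻¹]`-bilinearly to `LoopLam (2k)`. -/
def pbrL {k : ℕ} (f g : LoopLam (2 * k)) : LoopLam (2 * k) :=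
  f.sum fun m x => g.sum fun p y => Finsupp.single (m + p) (pbr x y)

/-- The contact bracket
`{f,g}_{k.b.} = (2−E)(f)·∂_t(g) − ∂_t(f)·(2−E)(g) − {f,g}_{P.b.}` on `LoopLam (2k)`;
this is the Lie superalgebra `k^L(1|2k)` in its generating-functions realization. -/
def kbr {k : ℕ} (f g : LoopLam (2 * k)) : LoopLam (2 * k) :=
  tmul ((2 : ℂ) • f - euler f) (dt g) - tmul (dt f) ((2 : ℂ) • g - euler g) - pbrL f g

/-- `f ∈ LoopLam n` is homogeneous of Grassmann degree `d` (its parity is `d % 2`). -/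
def IsHomogL {n : ℕ} (d : ℕ) (f : LoopLam n) : Prop :=
  ∀ (m : ℤ) (S : Finset (Fin n)), f m S ≠ 0 → S.card = d

end

noncomputable section

/-- `Res f`: the coefficient of `(1/t)·θ_1⋯θ_n` (the top Grassmann monomial over `t^{-1}`)
in the expansion of `f` in the monomial basis. -/
def ResL {n : ℕ} (f : LoopLam n) : ℂ := f (-1) Finset.univ

/-- The bilinear form `B(f,g) = Res (fg)` on `ℂ[t,t⁻¹] ⊗ Λ`. -/
def BRes {n : ℕ} (f g : LoopLam n) : ℂ := ResL (tmul f g)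

/-- The 2-cocycle `c(t^m ⊗ f, t^n ⊗ g) = δ_{m+n,0} · m · ∫ fg vol(θ)` on the loop
Poisson superalgebra, extended bilinearly. -/
def cocyc {n : ℕ} (f g : LoopLam n) : ℂ :=
  f.sum fun m x => (m : ℂ) * berez (gmul x (g (-m)))

/-- The bilinear form `B⁽¹⁾(t^m ⊗ f, t^n ⊗ g) = δ_{m+n,0} · ∫ fg vol(θ)` on the loop
algebra, extended bilinearly. -/
def Bloop {n : ℕ} (f g : LoopLam n) : ℂ :=
  f.sum fun m x => berez (gmul x (g (-m)))

end

set_option linter.unusedSectionVars false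

section AbsPoisson

variable {R : Type*} [NonUnitalRing R] [Module ℂ R] [IsScalarTower ℂ R R] [SMulCommClass ℂ R R]
  {ι : Type*} [Fintype ι]

/-- Abstract data. -/
structure PData (R : Type*) [NonUnitalRing R] [Module ℂ R] (ι : Type*) where
  σ : Equiv.Perm ι
  σσ : ∀ i, σ (σ i) = i
  P : R →ₗ[ℂ] R
  D : ι → R →ₗ[ℂ] R
  E : R →ₗ[ℂ] R
  P_mul : ∀ x y, P (x * y) = P x * P y
  D_mul : ∀ i x y, D i (x * y) = D i x * y + P x * D i y
  E_mul : ∀ x y, E (x * y) = E x * y + x * E y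
  PD : ∀ i x, P (D i x) = - D i (P x)
  ED : ∀ i x, E (D i x) = D i (E x) - D i x
  DD : ∀ i j x, D i (D j x) = - D j (D i x)
  comm : ∀ (p q : ℕ) x y, P x = (-1 : ℂ) ^ p • x → P y = (-1 : ℂ) ^ q • y →
    x * y = (-1 : ℂ) ^ (p * q) • (y * x)

namespace PData

variable (T : PData R ι)

/-- Parity. -/
def H (p : ℕ) (x : R) : Prop := T.P x = (-1 : ℂ) ^ p • x

/-- Abstract Poisson bracket. -/
def pb (x y : R) : R := ∑ i, T.P (T.D i x) * T.D (T.σ i) y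

variable {T} {p q r : ℕ} {x y z : R}

theorem H.D (h : T.H p x) (i : ι) : T.H (p + 1) (T.D i x) := by
  unfold H at *
  rw [T.PD, h, map_smul, pow_succ]; simp

theorem H.mul (h : T.H p x) (h' : T.H q y) : T.H (p + q) (x * y) := by
  unfold H at *
  rw [T.P_mul, h, h', pow_add, smul_mul_smul_comm]

theorem pb_hom (h : T.H p x) (y : R) :
    T.pb x y = -((-1 : ℂ) ^ p) • ∑ i, T.D i x * T.D (T.σ i) y := by
  unfold pb
  rw [Finset.smul_sum]
  refine Finset.sum_congr rfl fun i _ => ?_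
  rw [h.D i, pow_succ, smul_mul_assoc]; simp

theorem H.pb (h : T.H p x) (h' : T.H q y) : T.H (p + q) (T.pb x y) := by
  rw [pb_hom h]
  unfold H
  rw [map_smul, map_sum, smul_comm]
  congr 1
  rw [Finset.smul_sum]
  refine Finset.sum_congr rfl fun i _ => ?_
  rw [(h.D i).mul (h'.D _)]
  congr 1
  ring

theorem pb_mul (h : T.H p x) (h' : T.H q y) (z : R) :
    T.pb x (y * z) = T.pb x y * z + (-1 : ℂ) ^ (p * q) • (y * T.pb x z) := by
  simp only [pb_hom h, smul_mul_assoc, mul_smul_comm, Finset.sum_mul, Finset.mul_sum,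
    Finset.smul_sum, ← Finset.sum_add_distrib]
  refine Finset.sum_congr rfl fun i _ => ?_
  have c := T.comm _ _ _ _ (h.D i) h'
  have hy : T.P y = (-1 : ℂ) ^ q • y := h'
  rw [T.D_mul, hy, smul_mul_assoc, mul_add, mul_smul_comm, ← mul_assoc (T.D i x) y, c,
    smul_mul_assoc, smul_add, ← mul_assoc, ← mul_assoc]
  congr 1
  simp only [smul_smul]
  congr 1
  rcases neg_one_pow_eq_or ℂ p with hp | hp <;> rcases neg_one_pow_eq_or ℂ q with hq | hq <;>
    simp [add_mul, pow_add, pow_mul, hp, hq]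

theorem mul_pb (h : T.H p x) (h' : T.H q y) (h'' : T.H r z) :
    T.pb (x * y) z = x * T.pb y z + (-1 : ℂ) ^ (q * r) • (T.pb x z * y) := by
  simp only [pb_hom h, pb_hom h', pb_hom (h.mul h'), smul_mul_assoc, mul_smul_comm,
    Finset.sum_mul, Finset.mul_sum, Finset.smul_sum, ← Finset.sum_add_distrib]
  refine Finset.sum_congr rfl fun i _ => ?_
  have c := T.comm _ _ _ _ h' (h''.D (T.σ i))
  have hx : T.P x = (-1 : ℂ) ^ p • x := h
  rw [T.D_mul, hx, smul_mul_assoc, add_mul, mul_assoc _ y, c, mul_smul_comm, smul_mul_assoc,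
    smul_add, add_comm, ← mul_assoc, ← mul_assoc]
  simp only [smul_smul]
  congr 2 <;>
  rcases neg_one_pow_eq_or ℂ p with hp | hp <;> rcases neg_one_pow_eq_or ℂ q with hq | hq <;>
    rcases neg_one_pow_eq_or ℂ r with hr | hr <;>
    simp [mul_add, pow_add, pow_mul, hp, hq, hr]

theorem pb_symm (h : T.H p x) (h' : T.H q y) :
    T.pb y x = -((-1 : ℂ) ^ (p * q)) • T.pb x y := by
  rw [pb_hom h, pb_hom h', ← Equiv.sum_comp T.σ]
  simp only [Finset.smul_sum, smul_smul, T.σσ]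
  refine Finset.sum_congr rfl fun i _ => ?_
  rw [T.comm _ _ _ _ (h'.D _) (h.D _), smul_smul]
  congr 1
  rcases neg_one_pow_eq_or ℂ p with hp | hp <;> rcases neg_one_pow_eq_or ℂ q with hq | hq <;>
    simp [add_mul, mul_add, pow_add, pow_mul, hp, hq]

theorem pb_E {a b : ℂ} (h : T.H p x) (ha : T.E x = a • x) (hb : T.E y = b • y) :
    T.E (T.pb x y) = (a + b - 2) • T.pb x y := by
  rw [pb_hom h, map_smul, map_sum, smul_comm]
  congr 1
  rw [Finset.smul_sum]
  refine Finset.sum_congr rfl fun i _ => ?_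
  rw [T.E_mul, T.ED, T.ED, ha, hb, map_smul, map_smul, sub_mul, mul_sub, smul_mul_assoc,
    mul_smul_comm]
  module

theorem jac (h : T.H p x) (h' : T.H q y) (z : R) :
    T.pb x (T.pb y z) = T.pb (T.pb x y) z + (-1 : ℂ) ^ (p * q) • T.pb y (T.pb x z) := by
  set F1 : R := ∑ j, ∑ i, T.D j x * T.D (T.σ j) (T.D i y) * T.D (T.σ i) z with hF1
  set F2 : R := ∑ j, ∑ i, T.D j (T.D i x) * T.D (T.σ i) y * T.D (T.σ j) z with hF2
  set F3 : R := ∑ j, ∑ i, T.D j x * T.D i y * T.D (T.σ j) (T.D (T.σ i) z) with hF3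
  have e1 : T.pb x (T.pb y z) = (-1 : ℂ) ^ (p + q) • (F1 + (-1 : ℂ) ^ (q + 1) • F3) := by
    rw [hF1, hF3, pb_hom h]
    simp only [pb_hom h', map_smul, map_sum, mul_smul_comm, Finset.mul_sum, Finset.smul_sum,
      ← Finset.sum_add_distrib, smul_smul]
    refine Finset.sum_congr rfl fun j _ => Finset.sum_congr rfl fun i _ => ?_
    have hy : T.P (T.D i y) = (-1 : ℂ) ^ (q + 1) • T.D i y := h'.D i
    rw [T.D_mul, hy, smul_mul_assoc, mul_add, mul_smul_comm, ← mul_assoc, ← mul_assoc]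
    congr 1
    rw [pow_add]; ring
  have e2 : T.pb (T.pb x y) z = (-1 : ℂ) ^ q • (F2 + (-1 : ℂ) ^ p • F1) := by
    have hF1' : F1 = - ∑ j, ∑ i, T.D i x * T.D j (T.D (T.σ i) y) * T.D (T.σ j) z := by
      rw [hF1, Finset.sum_comm, ← Finset.sum_neg_distrib]
      refine Finset.sum_congr rfl fun j _ => ?_
      rw [← Finset.sum_neg_distrib]
      refine Finset.sum_congr rfl fun i _ => ?_
      rw [T.DD j]; simp
    rw [hF1', hF2, pb_hom (h.pb h')]
    simp only [pb_hom h, map_smul, map_sum, smul_mul_assoc, Finset.sum_mul, Finset.smul_sum,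
      ← Finset.sum_add_distrib, smul_smul, ← Finset.sum_neg_distrib]
    refine Finset.sum_congr rfl fun j _ => Finset.sum_congr rfl fun i _ => ?_
    have hy : T.P (T.D i x) = (-1 : ℂ) ^ (p + 1) • T.D i x := h.D i
    rw [T.D_mul, hy, smul_mul_assoc, add_mul, smul_mul_assoc, pow_succ, pow_add]
    rcases neg_one_pow_eq_or ℂ p with hp | hp <;> simp [hp]
  have hF2' : ∑ j, ∑ i, T.D j y * T.D (T.σ j) (T.D i x) * T.D (T.σ i) z =
      (-1 : ℂ) ^ (p * (q + 1) + 1) • F2 := by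
    rw [hF2, ← Equiv.sum_comp T.σ (fun j => ∑ i, T.D j y * T.D (T.σ j) (T.D i x) * T.D (T.σ i) z),
      Finset.sum_comm, Finset.smul_sum]
    refine Finset.sum_congr rfl fun j _ => ?_
    rw [Finset.smul_sum]
    refine Finset.sum_congr rfl fun i _ => ?_
    have c := T.comm _ _ _ _ (h'.D (T.σ i)) ((h.D j).D i)
    rw [T.σσ, c, T.DD i j, smul_mul_assoc, neg_mul, neg_mul, smul_neg, ← neg_smul]
    congr 1
    rcases neg_one_pow_eq_or ℂ p with hp | hp <;> rcases neg_one_pow_eq_or ℂ q with hq | hq <;>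
      simp [add_mul, mul_add, pow_add, pow_mul, hp, hq]
  have hF3' : ∑ j, ∑ i, T.D j y * T.D i x * T.D (T.σ j) (T.D (T.σ i) z) =
      (-1 : ℂ) ^ ((p + 1) * (q + 1) + 1) • F3 := by
    rw [hF3, Finset.sum_comm, Finset.smul_sum]
    refine Finset.sum_congr rfl fun j _ => ?_
    rw [Finset.smul_sum]
    refine Finset.sum_congr rfl fun i _ => ?_
    have c := T.comm _ _ _ _ (h'.D i) (h.D j)
    rw [c, T.DD (T.σ i), smul_mul_assoc, mul_neg, smul_neg, ← neg_smul]
    congr 1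
    rw [pow_succ, mul_comm (p + 1)]; ring
  have e3 : T.pb y (T.pb x z) = (-1 : ℂ) ^ (p + q) •
      ((-1 : ℂ) ^ (p * (q + 1) + 1) • F2 +
        (-1 : ℂ) ^ (p + 1) • (-1 : ℂ) ^ ((p + 1) * (q + 1) + 1) • F3) := by
    rw [← hF2', ← hF3', pb_hom h']
    simp only [pb_hom h, map_smul, map_sum, mul_smul_comm, Finset.mul_sum, Finset.smul_sum,
      ← Finset.sum_add_distrib, smul_smul]
    refine Finset.sum_congr rfl fun j _ => Finset.sum_congr rfl fun i _ => ?_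
    have hy : T.P (T.D i x) = (-1 : ℂ) ^ (p + 1) • T.D i x := h.D i
    rw [T.D_mul, hy, smul_mul_assoc, mul_add, mul_smul_comm, ← mul_assoc, ← mul_assoc]
    congr 1
    rw [pow_add]; ring
  rw [e1, e2, e3]
  rcases neg_one_pow_eq_or ℂ p with hp | hp <;> rcases neg_one_pow_eq_or ℂ q with hq | hq <;>
    simp [add_mul, mul_add, pow_add, pow_mul, hp, hq] <;> abel

end PData
end AbsPoisson

section LamAlg

/-- Basis monomial. -/
noncomputable def eb {n : ℕ} (S : Finset (Fin n)) : Lam n := Pi.single S 1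

theorem lam_ind {n : ℕ} {Q : Lam n → Prop} (h1 : ∀ S, Q (eb S))
    (h2 : ∀ (c : ℂ) x, Q x → Q (c • x)) (h3 : ∀ x y, Q x → Q y → Q (x + y)) (x : Lam n) : Q x := by
  have h0 : Q 0 := by simpa using h2 0 _ (h1 ∅)
  have hx : x = ∑ S, x S • eb S := by
    ext U
    simp [eb, Finset.sum_apply, Pi.single_apply]
  rw [hx]
  refine Finset.sum_induction _ Q h3 h0 fun S _ => h2 _ _ (h1 S)

variable {n : ℕ}

theorem gmul_add (x y z : Lam n) : gmul x (y + z) = gmul x y + gmul x z := by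
  ext U; simp [gmul, mul_add, Finset.sum_add_distrib]

theorem add_gmul (x y z : Lam n) : gmul (x + y) z = gmul x z + gmul y z := by
  ext U; simp [gmul, mul_add, add_mul, Finset.sum_add_distrib]

theorem smul_gmul (c : ℂ) (x y : Lam n) : gmul (c • x) y = c • gmul x y := by
  ext U; simp only [gmul, Pi.smul_apply, smul_eq_mul, Finset.mul_sum]
  exact Finset.sum_congr rfl fun _ _ => by ring

theorem gmul_smul (c : ℂ) (x y : Lam n) : gmul x (c • y) = c • gmul x y := by
  ext U; simp only [gmul, Pi.smul_apply, smul_eq_mul, Finset.mul_sum]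
  exact Finset.sum_congr rfl fun _ _ => by ring

theorem gmul_zero (x : Lam n) : gmul x 0 = 0 := by ext U; simp [gmul]
theorem zero_gmul (x : Lam n) : gmul 0 x = 0 := by ext U; simp [gmul]

theorem gmul_eb_of_disjoint {S T : Finset (Fin n)} (h : Disjoint S T) :
    gmul (eb S) (eb T) = ksign S T • eb (S ∪ T) := by
  ext U
  simp only [gmul, eb, Pi.smul_apply, smul_eq_mul, Pi.single_apply]
  by_cases hU : U = S ∪ T
  · subst hU
    rw [Finset.sum_eq_single S]
    · simp [Finset.union_sdiff_cancel_left h]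
    · intro A _ hA; simp [hA]
    · intro h'; exact (h' (Finset.mem_powerset.2 Finset.subset_union_left)).elim
  · rw [Finset.sum_eq_zero]
    · simp [hU]
    · intro A hA
      by_cases h1 : A = S
      · by_cases h2 : U \ A = T
        · exfalso; apply hU; rw [← h1, ← h2]
          exact (Finset.union_sdiff_of_subset (Finset.mem_powerset.1 hA)).symm
        · simp [h2]
      · simp [h1]

theorem gmul_eb_of_not_disjoint {S T : Finset (Fin n)} (h : ¬ Disjoint S T) :
    gmul (eb S) (eb T) = 0 := by
  ext U
  simp only [gmul, eb, Pi.zero_apply, Pi.single_apply]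
  refine Finset.sum_eq_zero fun A hA => ?_
  by_cases h1 : A = S
  · by_cases h2 : U \ A = T
    · exfalso; apply h; rw [← h1, ← h2]; exact Finset.disjoint_sdiff
    · simp [h2]
  · simp [h1]

theorem ksign_union_left {S T : Finset (Fin n)} (h : Disjoint S T) (U : Finset (Fin n)) :
    ksign (S ∪ T) U = ksign S U * ksign T U := by
  simp [ksign, Finset.sum_union h, pow_add]

theorem ksign_union_right {S T : Finset (Fin n)} (h : Disjoint S T) (U : Finset (Fin n)) :
    ksign U (S ∪ T) = ksign U S * ksign U T := by
  simp only [ksign, ← pow_add, ← Finset.sum_add_distrib]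
  congr 1
  refine Finset.sum_congr rfl fun s _ => ?_
  rw [Finset.filter_union, Finset.card_union_of_disjoint (Finset.disjoint_filter_filter h)]

theorem ksign_sq (S T : Finset (Fin n)) : ksign S T * ksign S T = 1 := by
  rw [ksign, ← pow_add, ← two_mul, pow_mul]; simp

theorem ksign_swap {S T : Finset (Fin n)} (h : Disjoint S T) :
    ksign S T = (-1 : ℂ) ^ (S.card * T.card) * ksign T S := by
  have key : ksign S T * ksign T S = (-1 : ℂ) ^ (S.card * T.card) := by
    simp only [ksign, ← pow_add]
    congr 1
    simp only [Finset.card_filter]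
    rw [Finset.sum_comm (s := T), ← Finset.sum_add_distrib]
    rw [← smul_eq_mul, ← Finset.sum_const]
    refine Finset.sum_congr rfl fun s hs => ?_
    rw [← Finset.sum_add_distrib, Finset.card_eq_sum_ones]
    refine Finset.sum_congr rfl fun t ht => ?_
    have : s ≠ t := fun e => (Finset.disjoint_left.1 h hs) (e ▸ ht)
    rcases lt_or_gt_of_ne this with h | h <;> simp [h, h.le]
  rw [← key, mul_assoc, ksign_sq, mul_one]

theorem gmul_assoc (x y z : Lam n) : gmul (gmul x y) z = gmul x (gmul y z) := by
  induction x using lam_ind with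
  | h2 c x h => simp only [smul_gmul, h]
  | h3 x y h h' => simp only [add_gmul, h, h']
  | h1 S =>
  induction y using lam_ind with
  | h2 c x h => simp only [smul_gmul, gmul_smul, h]
  | h3 x y h h' => simp only [add_gmul, gmul_add, h, h']
  | h1 T =>
  induction z using lam_ind with
  | h2 c x h => simp only [gmul_smul, h]
  | h3 x y h h' => simp only [gmul_add, h, h']
  | h1 U =>
  by_cases h1 : Disjoint S T
  · by_cases h2 : Disjoint T U
    · rw [gmul_eb_of_disjoint h1, gmul_eb_of_disjoint h2, smul_gmul, gmul_smul]
      by_cases h3 : Disjoint S U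
      · rw [gmul_eb_of_disjoint (Finset.disjoint_union_left.2 ⟨h3, h2⟩),
          gmul_eb_of_disjoint (Finset.disjoint_union_right.2 ⟨h1, h3⟩), ksign_union_left h1,
          ksign_union_right h2, Finset.union_assoc, smul_smul, smul_smul]
        congr 1; ring
      · rw [gmul_eb_of_not_disjoint fun h => h3 (Finset.disjoint_union_left.1 h).1,
          gmul_eb_of_not_disjoint fun h => h3 (Finset.disjoint_union_right.1 h).2]
        simp
    · rw [gmul_eb_of_disjoint h1, gmul_eb_of_not_disjoint h2, smul_gmul,
        gmul_eb_of_not_disjoint fun h => h2 (Finset.disjoint_union_left.1 h).2, gmul_zero, smul_zero]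
  · rw [gmul_eb_of_not_disjoint h1, zero_gmul]
    by_cases h2 : Disjoint T U
    · rw [gmul_eb_of_disjoint h2, gmul_smul,
        gmul_eb_of_not_disjoint fun h => h1 (Finset.disjoint_union_right.1 h).1, smul_zero]
    · rw [gmul_eb_of_not_disjoint h2, gmul_zero]

/-- Parity operator. -/
noncomputable def PL : Lam n →ₗ[ℂ] Lam n where
  toFun f S := (-1 : ℂ) ^ S.card * f S
  map_add' x y := by ext; simp [mul_add]
  map_smul' c x := by ext; simp; ring

/-- Euler operator. -/
noncomputable def EL : Lam n →ₗ[ℂ] Lam n where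
  toFun f S := (S.card : ℂ) * f S
  map_add' x y := by ext; simp [mul_add]
  map_smul' c x := by ext; simp; ring

/-- Odd derivation. -/
noncomputable def DL (i : Fin n) : Lam n →ₗ[ℂ] Lam n where
  toFun f := pd i f
  map_add' x y := by ext; simp only [pd, Pi.add_apply]; split_ifs <;> ring
  map_smul' c x := by
    ext; simp only [pd, Pi.smul_apply, smul_eq_mul, RingHom.id_apply]; split_ifs <;> ring

theorem PL_mul (x y : Lam n) : PL (gmul x y) = gmul (PL x) (PL y) := by
  ext U
  simp only [PL, gmul, LinearMap.coe_mk, AddHom.coe_mk, Finset.mul_sum]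
  refine Finset.sum_congr rfl fun S hS => ?_
  rw [← Finset.card_sdiff_add_card_eq_card (Finset.mem_powerset.1 hS), pow_add]; ring

theorem EL_mul (x y : Lam n) : EL (gmul x y) = gmul (EL x) y + gmul x (EL y) := by
  ext U
  simp only [EL, gmul, LinearMap.coe_mk, AddHom.coe_mk, Finset.mul_sum, Pi.add_apply,
    ← Finset.sum_add_distrib]
  refine Finset.sum_congr rfl fun S hS => ?_
  rw [← Finset.card_sdiff_add_card_eq_card (Finset.mem_powerset.1 hS)]; push_cast; ring

theorem PL_DL (i : Fin n) (x : Lam n) : PL (DL i x) = - DL i (PL x) := by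
  ext U
  simp only [PL, DL, pd, LinearMap.coe_mk, AddHom.coe_mk, Pi.neg_apply]
  split_ifs with h
  · simp
  · rw [Finset.card_insert_of_notMem h, pow_succ]; ring

theorem EL_DL (i : Fin n) (x : Lam n) : EL (DL i x) = DL i (EL x) - DL i x := by
  ext U
  simp only [EL, DL, pd, LinearMap.coe_mk, AddHom.coe_mk, Pi.sub_apply]
  split_ifs with h
  · simp
  · rw [Finset.card_insert_of_notMem h]; push_cast; ring

theorem ksign_single (i : Fin n) (S : Finset (Fin n)) :
    ksign {i} S = (-1 : ℂ) ^ (S.filter (fun j => j < i)).card := by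
  simp [ksign]

theorem DL_DL (i j : Fin n) (x : Lam n) : DL i (DL j x) = - DL j (DL i x) := by
  ext U
  simp only [DL, pd, LinearMap.coe_mk, AddHom.coe_mk, Pi.neg_apply, ← ksign_single]
  by_cases hij : i = j
  · subst hij; simp
  by_cases hi : i ∈ U
  · simp [hi]
  by_cases hj : j ∈ U
  · simp [hj]
  have hij' : ¬ j = i := fun h => hij h.symm
  simp only [hi, hj, Finset.mem_insert, hij, hij', or_self, if_false]
  have a1 : insert i U = {i} ∪ U := rfl
  have a2 : insert j U = {j} ∪ U := rfl
  rw [Finset.insert_comm j i, a1, a2, ksign_union_right (by simpa using hi),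
    ksign_union_right (by simpa using hj), ksign_swap (S := {j}) (T := {i}) (by simpa using hij')]
  simp; ring

theorem DL_eb_notMem {i : Fin n} {S : Finset (Fin n)} (h : i ∉ S) : DL i (eb S) = 0 := by
  ext U
  simp only [DL, pd, eb, LinearMap.coe_mk, AddHom.coe_mk, Pi.single_apply, Pi.zero_apply]
  split_ifs with h1 h2
  · rfl
  · exact (h (h2 ▸ Finset.mem_insert_self i U)).elim
  · simp

theorem DL_eb_insert {i : Fin n} {S : Finset (Fin n)} (h : i ∉ S) :
    DL i (eb ({i} ∪ S)) = ksign {i} S • eb S := by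
  ext U
  simp only [DL, pd, eb, LinearMap.coe_mk, AddHom.coe_mk, Pi.single_apply, Pi.smul_apply,
    ← ksign_single, smul_eq_mul]
  by_cases hU : U = S
  · subst hU; simp [h]
  · by_cases h1 : i ∈ U
    · simp [h1, hU]
    · have : insert i U ≠ {i} ∪ S := by
        intro e
        apply hU
        rw [← Finset.erase_insert h1, e, ← Finset.insert_eq, Finset.erase_insert h]
      rw [if_neg h1, if_neg this, if_neg hU, mul_zero, mul_zero]

theorem PL_eb (S : Finset (Fin n)) : PL (eb S) = (-1 : ℂ) ^ S.card • eb S := by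
  ext U
  simp only [PL, eb, LinearMap.coe_mk, AddHom.coe_mk, Pi.single_apply, Pi.smul_apply, smul_eq_mul]
  split_ifs with h
  · rw [h]
  · simp

theorem DL_mul (i : Fin n) (x y : Lam n) :
    DL i (gmul x y) = gmul (DL i x) y + gmul (PL x) (DL i y) := by
  induction x using lam_ind with
  | h2 c x h => simp only [smul_gmul, h, map_smul, smul_add]
  | h3 x y h h' => simp only [add_gmul, h, h', map_add]; abel
  | h1 S =>
  induction y using lam_ind with
  | h2 c x h => simp only [gmul_smul, h, map_smul, smul_add]
  | h3 x y h h' => simp only [gmul_add, h, h', map_add]; abel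
  | h1 T =>
  rw [PL_eb, smul_gmul]
  by_cases hS : i ∈ S
  · obtain ⟨S, hiS, rfl⟩ : ∃ S', i ∉ S' ∧ S = {i} ∪ S' :=
      ⟨S.erase i, by simp, by rw [← Finset.insert_eq, Finset.insert_erase hS]⟩
    have dS : Disjoint {i} S := by simpa using hiS
    rw [DL_eb_insert hiS, smul_gmul]
    by_cases hT : i ∈ T
    · obtain ⟨T, hiT, rfl⟩ : ∃ S', i ∉ S' ∧ T = {i} ∪ S' :=
        ⟨T.erase i, by simp, by rw [← Finset.insert_eq, Finset.insert_erase hT]⟩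
      have dT : Disjoint {i} T := by simpa using hiT
      rw [DL_eb_insert hiT, gmul_smul, gmul_eb_of_not_disjoint (by
        rw [Finset.not_disjoint_iff]; exact ⟨i, hS, hT⟩), map_zero]
      by_cases h : Disjoint S T
      · have d1 : Disjoint S ({i} ∪ T) := Finset.disjoint_union_right.2 ⟨dS.symm, h⟩
        have d2 : Disjoint ({i} ∪ S) T := Finset.disjoint_union_left.2 ⟨dT, h⟩
        rw [gmul_eb_of_disjoint d1, gmul_eb_of_disjoint d2, ksign_union_left dS,
          ksign_union_right dT, ← Finset.union_assoc, Finset.union_comm S {i},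
          Finset.card_union_of_disjoint dS, ksign_swap dS.symm]
        simp only [smul_smul, ← add_smul]
        rw [eq_comm]
        convert zero_smul ℂ _
        have e1 := ksign_sq {i} S
        have e2 := ksign_sq {i} T
        simp only [Finset.card_singleton, mul_one, pow_add, pow_one]
        linear_combination (-1 : ℂ) ^ S.card * ksign S T * e1 - (-1 : ℂ) ^ S.card * ksign S T * e2
      · rw [gmul_eb_of_not_disjoint fun h' => h (Finset.disjoint_union_right.1 h').2,
          gmul_eb_of_not_disjoint fun h' => h (Finset.disjoint_union_left.1 h').2]
        simp
    · have dT : Disjoint {i} T := by simpa using hT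
      rw [DL_eb_notMem hT, gmul_zero, smul_zero, add_zero]
      by_cases h : Disjoint S T
      · have d2 : Disjoint ({i} ∪ S) T := Finset.disjoint_union_left.2 ⟨dT, h⟩
        rw [gmul_eb_of_disjoint h, gmul_eb_of_disjoint d2, map_smul, Finset.union_assoc,
          DL_eb_insert (by simp [hiS, hT]), ksign_union_left dS, ksign_union_right h,
          smul_smul, smul_smul]
        congr 1
        linear_combination ksign {i} S * ksign S T * ksign_sq {i} T
      · rw [gmul_eb_of_not_disjoint h,
          gmul_eb_of_not_disjoint fun h' => h (Finset.disjoint_union_left.1 h').2]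
        simp
  · rw [DL_eb_notMem hS, zero_gmul, zero_add]
    have dS : Disjoint {i} S := by simpa using hS
    by_cases hT : i ∈ T
    · obtain ⟨T, hiT, rfl⟩ : ∃ S', i ∉ S' ∧ T = {i} ∪ S' :=
        ⟨T.erase i, by simp, by rw [← Finset.insert_eq, Finset.insert_erase hT]⟩
      have dT : Disjoint {i} T := by simpa using hiT
      rw [DL_eb_insert hiT, gmul_smul]
      by_cases h : Disjoint S T
      · have d1 : Disjoint S ({i} ∪ T) := Finset.disjoint_union_right.2 ⟨dS.symm, h⟩
        rw [gmul_eb_of_disjoint d1, gmul_eb_of_disjoint h, map_smul, Finset.union_left_comm,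
          DL_eb_insert (by simp [hiT, hS]), ksign_union_right dT, ksign_union_right h,
          ksign_swap dS.symm]
        simp only [smul_smul, Finset.card_singleton, mul_one]
        congr 1
        linear_combination (-1 : ℂ) ^ S.card * ksign S T * ksign {i} T * ksign_sq {i} S
      · rw [gmul_eb_of_not_disjoint h,
          gmul_eb_of_not_disjoint fun h' => h (Finset.disjoint_union_right.1 h').2]
        simp
    · rw [DL_eb_notMem hT, gmul_zero, smul_zero]
      by_cases h : Disjoint S T
      · rw [gmul_eb_of_disjoint h, map_smul, DL_eb_notMem (by simp [hS, hT]), smul_zero]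
      · rw [gmul_eb_of_not_disjoint h, map_zero]

theorem gmul_comm_of (p q : ℕ) (x y : Lam n) (hx : PL x = (-1 : ℂ) ^ p • x)
    (hy : PL y = (-1 : ℂ) ^ q • y) : gmul x y = (-1 : ℂ) ^ (p * q) • gmul y x := by
  have par : ∀ (p : ℕ) (x : Lam n), PL x = (-1 : ℂ) ^ p • x → ∀ S, x S ≠ 0 →
      (-1 : ℂ) ^ S.card = (-1 : ℂ) ^ p := by
    intro p x h S hS
    have := congrFun h S
    simp only [PL, LinearMap.coe_mk, AddHom.coe_mk, Pi.smul_apply, smul_eq_mul] at this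
    exact mul_right_cancel₀ hS this
  ext U
  simp only [gmul, Pi.smul_apply, smul_eq_mul, Finset.mul_sum]
  refine Finset.sum_bij' (fun S _ => U \ S) (fun S _ => U \ S) ?_ ?_ ?_ ?_ ?_
  · intro S _; simp
  · intro S _; simp
  · intro S hS; simpa using hS
  · intro S hS; simpa using hS
  · intro S hS
    have hS' : U \ (U \ S) = S := by simpa using hS
    rw [hS']
    by_cases h1 : x S = 0
    · simp [h1]
    by_cases h2 : y (U \ S) = 0
    · simp [h2]
    rw [ksign_swap Finset.disjoint_sdiff, pow_mul, par p x hx S h1, ← pow_mul, mul_comm p,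
      pow_mul, par q y hy _ h2, ← pow_mul, mul_comm q]
    ring

end LamAlg

section LoopPart

/-- Grassmann algebra with its ring structure. -/
def GA (n : ℕ) := Lam n

noncomputable instance (n : ℕ) : AddCommGroup (GA n) := inferInstanceAs (AddCommGroup (Lam n))
noncomputable instance (n : ℕ) : Module ℂ (GA n) := inferInstanceAs (Module ℂ (Lam n))

noncomputable instance (n : ℕ) : NonUnitalRing (GA n) where
  __ := (inferInstance : AddCommGroup (GA n))
  mul := fun x y => gmul (n := n) x y
  left_distrib := gmul_add (n := n)
  right_distrib := add_gmul (n := n)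
  zero_mul := zero_gmul (n := n)
  mul_zero := gmul_zero (n := n)
  mul_assoc := gmul_assoc (n := n)

instance (n : ℕ) : IsScalarTower ℂ (GA n) (GA n) := ⟨fun c x y => smul_gmul (n := n) c x y⟩
instance (n : ℕ) : SMulCommClass ℂ (GA n) (GA n) := ⟨fun c x y => (gmul_smul (n := n) c x y).symm⟩

/-- Index map. -/
def thIdx {k : ℕ} : Fin k ⊕ Fin k → Fin (2 * k) := Sum.elim xIdx yIdx

/-- The Poisson data of the Grassmann algebra. -/
noncomputable def GT (k : ℕ) : PData (GA (2 * k)) (Fin k ⊕ Fin k) where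
  σ := Equiv.sumComm _ _
  σσ := by rintro (i | i) <;> rfl
  P := PL (n := 2 * k)
  D i := DL (n := 2 * k) (thIdx i)
  E := EL (n := 2 * k)
  P_mul := PL_mul (n := 2 * k)
  D_mul i := DL_mul (n := 2 * k) (thIdx i)
  E_mul := EL_mul (n := 2 * k)
  PD i := PL_DL (n := 2 * k) (thIdx i)
  ED i := EL_DL (n := 2 * k) (thIdx i)
  DD i j := DL_DL (n := 2 * k) (thIdx i) (thIdx j)
  comm p q x y hx hy := gmul_comm_of (n := 2 * k) p q x y hx hy

variable {k : ℕ}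

theorem pbr_eq (x y : Lam (2 * k)) : pbr x y = (GT k).pb x y := by
  have hs : ∀ i : Fin (2 * k), pd i (sgnF x) = PL (DL i x) := by
    intro i
    rw [PL_DL, ← map_neg]
    show pd i (sgnF x) = pd i _
    congr 1
    ext S
    simp [sgnF, PL]
  unfold pbr PData.pb
  rw [Fintype.sum_sum_type, ← Finset.sum_add_distrib]
  refine Finset.sum_congr rfl fun j _ => ?_
  rw [hs, hs]
  rfl

/-- Convolution extension of a bilinear map. -/
noncomputable def convL {n : ℕ} (B : Lam n →ₗ[ℂ] Lam n →ₗ[ℂ] Lam n) :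
    LoopLam n →ₗ[ℂ] LoopLam n →ₗ[ℂ] LoopLam n :=
  Finsupp.lsum ℂ fun m : ℤ => LinearMap.flip (Finsupp.lsum ℂ fun p : ℤ =>
    LinearMap.flip (B.compr₂ (Finsupp.lsingle (m + p))))

theorem convL_apply {n : ℕ} (B : Lam n →ₗ[ℂ] Lam n →ₗ[ℂ] Lam n) (f g : LoopLam n) :
    convL B f g = f.sum fun m x => g.sum fun p y => Finsupp.single (m + p) (B x y) := by
  simp only [convL, Finsupp.lsum_apply, Finsupp.sum, LinearMap.sum_apply, LinearMap.flip_apply]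
  rfl

theorem convL_single {n : ℕ} (B : Lam n →ₗ[ℂ] Lam n →ₗ[ℂ] Lam n) (a b : ℤ) (x y : Lam n) :
    convL B (Finsupp.single a x) (Finsupp.single b y) = Finsupp.single (a + b) (B x y) := by
  rw [convL_apply, Finsupp.sum_single_index, Finsupp.sum_single_index] <;> simp

/-- Bilinear product. -/
noncomputable def gmulL {n : ℕ} : Lam n →ₗ[ℂ] Lam n →ₗ[ℂ] Lam n :=
  LinearMap.mk₂ ℂ gmul add_gmul smul_gmul gmul_add gmul_smul

/-- Bilinear Poisson bracket. -/
noncomputable def pbL : Lam (2 * k) →ₗ[ℂ] Lam (2 * k) →ₗ[ℂ] Lam (2 * k) :=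
  ∑ i : Fin k ⊕ Fin k, gmulL.compl₁₂ (PL ∘ₗ DL (thIdx i)) (DL (thIdx (Equiv.sumComm _ _ i)))

theorem pbL_apply (x y : Lam (2 * k)) : pbL x y = pbr x y := by
  rw [pbr_eq]
  simp only [pbL, LinearMap.sum_apply]
  rfl

/-- Linear `dt`. -/
noncomputable def dtL {n : ℕ} : LoopLam n →ₗ[ℂ] LoopLam n :=
  Finsupp.lsum ℂ fun m : ℤ => (m : ℂ) • Finsupp.lsingle (m - 1)

theorem dtL_apply {n : ℕ} (f : LoopLam n) : dtL f = dt f := by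
  simp only [dtL, dt, Finsupp.lsum_apply, Finsupp.sum, LinearMap.smul_apply,
    Finsupp.lsingle_apply, Finsupp.smul_single]

/-- Linear `euler`. -/
noncomputable def eulerL {n : ℕ} : LoopLam n →ₗ[ℂ] LoopLam n :=
  Finsupp.lsum ℂ fun m : ℤ => Finsupp.lsingle m ∘ₗ EL

theorem eulerL_apply {n : ℕ} (f : LoopLam n) : eulerL f = euler f := by
  simp only [eulerL, euler, Finsupp.lsum_apply]
  rfl

/-- The operator `2 - E`. -/
noncomputable def tE {n : ℕ} : LoopLam n →ₗ[ℂ] LoopLam n := (2 : ℂ) • LinearMap.id - eulerL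

/-- Bilinear contact bracket. -/
noncomputable def K : LoopLam (2 * k) →ₗ[ℂ] LoopLam (2 * k) →ₗ[ℂ] LoopLam (2 * k) :=
  (convL (n := 2 * k) gmulL).compl₁₂ tE dtL
   + (-1 : ℂ) • (convL (n := 2 * k) gmulL).compl₁₂ dtL tE + (-1 : ℂ) • convL pbL

theorem kbr_eq (f g : LoopLam (2 * k)) : kbr f g = K f g := by
  have h1 : ∀ f g : LoopLam (2 * k), convL gmulL f g = tmul f g := fun f g => by
    rw [convL_apply]; rfl
  have h2 : ∀ f g : LoopLam (2 * k), convL pbL f g = pbrL f g := fun f g => by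
    rw [convL_apply]; simp only [pbL_apply]; rfl
  have h3 : ∀ f : LoopLam (2 * k), tE f = (2 : ℂ) • f - euler f := fun f => by
    rw [← eulerL_apply]; rfl
  simp only [K, kbr, LinearMap.add_apply, LinearMap.smul_apply, LinearMap.compl₁₂_apply, h1, h2, h3,
    dtL_apply]
  module

theorem K_single_aux (a b : ℤ) (x y : Lam (2 * k)) (p q : ℂ) (hx : EL x = p • x)
    (hy : EL y = q • y) :
    K (Finsupp.single a x : LoopLam (2 * k)) (Finsupp.single b y : LoopLam (2 * k)) =
      ((2 - p) * b - a * (2 - q)) • (Finsupp.single (a + b - 1) (gmul x y) : LoopLam (2 * k))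
        - (Finsupp.single (a + b) (pbr x y) : LoopLam (2 * k)) := by
  have hd : ∀ (a : ℤ) (x : Lam (2 * k)), dtL (Finsupp.single a x : LoopLam (2 * k)) =
      (a : ℂ) • (Finsupp.single (a - 1) x : LoopLam (2 * k)) := by
    intro a x; simp [dtL]
  have he : ∀ (a : ℤ) (x : Lam (2 * k)) (p : ℂ), EL x = p • x →
      tE (Finsupp.single a x : LoopLam (2 * k)) =
      (2 - p) • (Finsupp.single a x : LoopLam (2 * k)) := by
    intro a x p h
    have : eulerL (Finsupp.single a x : LoopLam (2 * k)) = p • Finsupp.single a x := by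
      simp [eulerL, h]
    rw [tE, LinearMap.sub_apply, this, sub_smul]; rfl
  have hm : gmulL (n := 2 * k) x y = gmul x y := rfl
  have hp : pbL (k := k) x y = pbr x y := pbL_apply x y
  simp only [K, LinearMap.add_apply, LinearMap.smul_apply, LinearMap.compl₁₂_apply]
  rw [hd, hd, he a x p hx, he b y q hy]
  simp only [map_smul, LinearMap.smul_apply, convL_single]
  rw [hm, hp, show a + (b - 1) = a + b - 1 by ring, show a - 1 + b = a + b - 1 by ring]
  module

/-- `single` on `GA`. -/
noncomputable def sg {n : ℕ} (m : ℤ) : GA n →ₗ[ℂ] LoopLam n := Finsupp.lsingle (M := Lam n) m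

theorem K_single (a b : ℤ) (x y : GA (2 * k)) (p q : ℂ) (hx : (GT k).E x = p • x)
    (hy : (GT k).E y = q • y) :
    K (sg a x) (sg b y) =
      ((2 - p) * b - a * (2 - q)) • sg (a + b - 1) (x * y) - sg (a + b) ((GT k).pb x y) := by
  have h := K_single_aux a b (x : Lam (2 * k)) (y : Lam (2 * k)) p q hx hy
  have h2 : pbr (k := k) x y = (GT k).pb x y := pbr_eq x y
  refine h.trans ?_
  exact congrArg₂ (· - ·) rfl (congrArg (Finsupp.single (M := Lam (2 * k)) (a + b)) h2)

theorem K_jac (a b c : ℤ) (x y z : GA (2 * k)) (p q r : ℕ)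
    (hx : (GT k).E x = (p : ℂ) • x) (hy : (GT k).E y = (q : ℂ) • y)
    (hz : (GT k).E z = (r : ℂ) • z)
    (px : (GT k).H p x) (py : (GT k).H q y) (pz : (GT k).H r z) :
    K (sg a x)
      (K (sg b y) (sg c z)) =
    K (K (sg a x) (sg b y))
      (sg c z) +
    (-1 : ℂ) ^ (p * q) • K (sg b y)
      (K (sg a x) (sg c z)) := by
  have Em : ∀ {x y : GA (2 * k)} {p q : ℂ}, (GT k).E x = p • x → (GT k).E y = q • y →
      (GT k).E (x * y) = (p + q) • (x * y) := by
    intro x y p q h h'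
    rw [(GT k).E_mul, h, h', smul_mul_assoc, mul_smul_comm, add_smul]
  rw [K_single _ _ _ _ _ _ hy hz, K_single _ _ _ _ _ _ hx hy, K_single _ _ _ _ _ _ hx hz]
  simp only [map_sub, map_smul, LinearMap.sub_apply, LinearMap.smul_apply]
  rw [K_single _ _ _ _ _ _ hx (Em hy hz), K_single _ _ _ _ _ _ hx (PData.pb_E py hy hz),
    K_single _ _ _ _ _ _ (Em hx hy) hz, K_single _ _ _ _ _ _ (PData.pb_E px hx hy) hz,
    K_single _ _ _ _ _ _ hy (Em hx hz), K_single _ _ _ _ _ _ hy (PData.pb_E px hx hz)]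
  rw [PData.jac px py z, PData.pb_mul px py, PData.mul_pb px py pz, PData.pb_mul py px,
    PData.pb_symm px py]
  have c1 : y * (x * z) = (-1 : ℂ) ^ (p * q) • (x * (y * z)) := by
    rw [← mul_assoc, (GT k).comm _ _ _ _ py px, smul_mul_assoc, mul_assoc, mul_comm q]
  have c2 : (-1 : ℂ) ^ (q * r) • ((GT k).pb x z * y) = (-1 : ℂ) ^ (p * q) • (y * (GT k).pb x z) := by
    rw [(GT k).comm _ _ _ _ (px.pb pz) py, smul_smul]
    congr 1
    rcases neg_one_pow_eq_or ℂ p with hp | hp <;> rcases neg_one_pow_eq_or ℂ q with hq | hq <;>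
      rcases neg_one_pow_eq_or ℂ r with hr | hr <;>
      simp [add_mul, pow_add, pow_mul, hp, hq, hr]
  rw [c1, c2, mul_assoc x y z, mul_comm q p]
  rw [show a + (b + c - 1) - 1 = a + b + c - 2 by ring,
    show a + b - 1 + c - 1 = a + b + c - 2 by ring,
    show b + (a + c - 1) - 1 = a + b + c - 2 by ring,
    show a + (b + c - 1) = a + b + c - 1 by ring,
    show a + b - 1 + c = a + b + c - 1 by ring,
    show b + (a + c - 1) = a + b + c - 1 by ring,
    show a + (b + c) = a + b + c by ring,
    show b + (a + c) = a + b + c by ring]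
  simp only [smul_mul_assoc, map_add, map_smul]
  push_cast
  rcases neg_one_pow_eq_or ℂ (p * q) with hs | hs <;> rw [hs] <;> module

theorem loop_van {n : ℕ} (φ : LoopLam n →ₗ[ℂ] LoopLam n) (f : LoopLam n)
    (h : ∀ m, φ (Finsupp.single m (f m)) = 0) : φ f = 0 := by
  conv_lhs => rw [← f.sum_single]
  rw [Finsupp.sum, map_sum]
  exact Finset.sum_eq_zero fun m _ => h m

theorem homog_E {d : ℕ} {f : LoopLam (2 * k)} (hf : IsHomogL d f) (m : ℤ) :
    (GT k).E (f m) = ((d : ℂ) • f m : Lam (2 * k)) := by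
  show EL (f m) = _
  ext S
  simp only [EL, LinearMap.coe_mk, AddHom.coe_mk, Pi.smul_apply, smul_eq_mul]
  by_cases h : f m S = 0
  · simp [h]
  · rw [hf m S h]

theorem homog_H {d : ℕ} {f : LoopLam (2 * k)} (hf : IsHomogL d f) (m : ℤ) :
    (GT k).H d (f m) := by
  show PL (f m) = (((-1 : ℂ) ^ d) • f m : Lam (2 * k))
  ext S
  simp only [PL, LinearMap.coe_mk, AddHom.coe_mk, Pi.smul_apply, smul_eq_mul]
  by_cases h : f m S = 0
  · simp [h]
  · rw [hf m S h]

end LoopPart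

/-- For homogeneous `f, g, h ∈ A`, the contact bracket satisfies the super
Jacobi identity:
`{f,{g,h}_{k.b.}}_{k.b.} = {{f,g}_{k.b.},h}_{k.b.} + (−1)^{p(f)p(g)} {g,{f,h}_{k.b.}}_{k.b.}`. -/
theorem kbr_super_jacobi (k : ℕ) (hk : 1 ≤ k) (df dg dh : ℕ)
    (f g h : LoopLam (2 * k)) (hf : IsHomogL df f) (hg : IsHomogL dg g)
    (hh : IsHomogL dh h) :
    kbr f (kbr g h) = kbr (kbr f g) h + ((-1 : ℂ) ^ (df * dg)) • kbr g (kbr f h) := by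
  simp only [kbr_eq]
  set s : ℂ := (-1 : ℂ) ^ (df * dg) with hs
  have h1 := loop_van (K.flip (K g h) - K.flip h ∘ₗ K.flip g - s • (K g ∘ₗ K.flip h)) f ?_
  · simp only [LinearMap.sub_apply, LinearMap.smul_apply, LinearMap.comp_apply,
      LinearMap.flip_apply] at h1
    rw [sub_sub, sub_eq_zero] at h1
    exact h1
  intro a
  have h2 := loop_van (K (Finsupp.single a (f a)) ∘ₗ K.flip h
    - K.flip h ∘ₗ K (Finsupp.single a (f a)) - s • K.flip (K (Finsupp.single a (f a)) h)) g ?_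
  · simpa only [LinearMap.sub_apply, LinearMap.smul_apply, LinearMap.comp_apply,
      LinearMap.flip_apply] using h2
  intro b
  have h3 := loop_van (K (Finsupp.single a (f a)) ∘ₗ K (Finsupp.single b (g b))
    - K (K (Finsupp.single a (f a)) (Finsupp.single b (g b)))
    - s • (K (Finsupp.single b (g b)) ∘ₗ K (Finsupp.single a (f a)))) h ?_
  · simpa only [LinearMap.sub_apply, LinearMap.smul_apply, LinearMap.comp_apply,
      LinearMap.flip_apply] using h3
  intro c
  simp only [LinearMap.sub_apply, LinearMap.smul_apply, LinearMap.comp_apply]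
  rw [sub_sub, sub_eq_zero]
  exact K_jac a b c (f a) (g b) (h c) df dg dh (homog_E hf a) (homog_E hg b) (homog_E hh c)
    (homog_H hf a) (homog_H hg b) (homog_H hh c)
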